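/- arXiv:1707.02608 — 3 statements merged into one kernel-verified Lean document; each statement's English description precedes it below -/
import Mathlib

section
/- Let u be a smooth decaying solution of KdV on the right half-line over a time interval I. Then for every t in the interior of I, (d/dt) ∫₀^∞ ( (1/2)(∂_x u)²(x,t) − (1/3)u³(x,t) ) dx = −∂_t u(0,t)·∂_x u(0,t) − (1/2)·( ∂_x² u(0,t) + u(0,t)² )². -/
open MeasureTheory Set Filter

/-- A smooth decaying solution of KdV `∂_t u + ∂_x(∂_x² u + u²) = 0` on the right
half-line `[0,∞)`, over a time interval `I`: smooth, satisfying the equation for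
`x ≥ 0`, `t ∈ I`, with `u(·,t)` and its `x`-derivatives up to order three
integrable and square integrable on `(0,∞)` and tending to `0` as `x → +∞`,
these bounds being locally uniform in `t`. -/
structure RightKdVSolution (u : ℝ → ℝ → ℝ) (I : Set ℝ) : Prop where
  smooth : ContDiff ℝ (⊤ : ℕ∞) (Function.uncurry u)
  eqn : ∀ x ∈ Ici (0 : ℝ), ∀ t ∈ I,
    deriv (fun s => u x s) t
      + deriv (fun y => iteratedDeriv 2 (fun z => u z t) y + (u y t) ^ 2) x = 0
  decay : ∀ t ∈ I, ∀ n ≤ 3,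
    Tendsto (fun x => iteratedDeriv n (fun z => u z t) x) atTop (nhds 0)
  int1 : ∀ t ∈ I, ∀ n ≤ 3,
    IntegrableOn (fun x => iteratedDeriv n (fun z => u z t) x) (Ioi 0)
  int2 : ∀ t ∈ I, ∀ n ≤ 3,
    IntegrableOn (fun x => (iteratedDeriv n (fun z => u z t) x) ^ 2) (Ioi 0)
  locUnif : ∀ t ∈ I, ∃ ε > 0, ∃ g : ℝ → ℝ, IntegrableOn g (Ioi 0) ∧
    ∀ s ∈ I, |s - t| < ε → ∀ x ∈ Ioi (0 : ℝ), ∀ n ≤ 3,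
      |iteratedDeriv n (fun z => u z s) x| + (iteratedDeriv n (fun z => u z s) x) ^ 2 ≤ g x

namespace KdVAux

noncomputable def D1 (f : ℝ × ℝ → ℝ) : ℝ × ℝ → ℝ := fun p => fderiv ℝ f p (1, 0)
noncomputable def D2 (f : ℝ × ℝ → ℝ) : ℝ × ℝ → ℝ := fun p => fderiv ℝ f p (0, 1)

lemma cd_D1 {f : ℝ × ℝ → ℝ} (hf : ContDiff ℝ (⊤ : ℕ∞) f) : ContDiff ℝ (⊤ : ℕ∞) (D1 f) :=
  (hf.fderiv_right (m := (⊤ : ℕ∞)) (by simp)).clm_apply contDiff_const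

lemma cd_D2 {f : ℝ × ℝ → ℝ} (hf : ContDiff ℝ (⊤ : ℕ∞) f) : ContDiff ℝ (⊤ : ℕ∞) (D2 f) :=
  (hf.fderiv_right (m := (⊤ : ℕ∞)) (by simp)).clm_apply contDiff_const

lemma hd1 {f : ℝ × ℝ → ℝ} (hf : ContDiff ℝ (⊤ : ℕ∞) f) (x t : ℝ) :
    HasDerivAt (fun y => f (y, t)) (D1 f (x, t)) x := by
  have h := (hf.differentiable (by simp) (x, t)).hasFDerivAt
  exact h.comp_hasDerivAt x ((hasDerivAt_id x).prodMk (hasDerivAt_const x t))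

lemma hd2 {f : ℝ × ℝ → ℝ} (hf : ContDiff ℝ (⊤ : ℕ∞) f) (x t : ℝ) :
    HasDerivAt (fun s => f (x, s)) (D2 f (x, t)) t := by
  have h := (hf.differentiable (by simp) (x, t)).hasFDerivAt
  exact h.comp_hasDerivAt t ((hasDerivAt_const t x).prodMk (hasDerivAt_id t))

lemma comm12 {f : ℝ × ℝ → ℝ} (hf : ContDiff ℝ (⊤ : ℕ∞) f) (p : ℝ × ℝ) :
    D1 (D2 f) p = D2 (D1 f) p := by
  have hs : IsSymmSndFDerivAt ℝ f p :=
    hf.contDiffAt.isSymmSndFDerivAt (by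
      rw [minSmoothness_of_isRCLikeNormedField]
      exact WithTop.coe_le_coe.2 (le_top : (2 : ℕ∞) ≤ ⊤))
  have hd : DifferentiableAt ℝ (fderiv ℝ f) p :=
    (hf.fderiv_right (m := (⊤ : ℕ∞)) (by simp)).differentiable (by simp) p
  have key : ∀ v w : ℝ × ℝ, fderiv ℝ (fun q => fderiv ℝ f q v) p w
      = fderiv ℝ (fderiv ℝ f) p w v := by
    intro v w
    rw [fderiv_clm_apply hd (differentiableAt_const v)]
    simp
  unfold D1 D2
  rw [key, key]
  exact hs _ _

/-- The filter of points tending to infinity along which `g` tends to zero. -/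
lemma neBot_aux {g : ℝ → ℝ} (hg : IntegrableOn g (Ioi 0)) :
    NeBot (atTop ⊓ comap g (nhds 0)) := by
  rw [inf_neBot_iff]
  intro s hs s' hs'
  obtain ⟨a, ha⟩ := mem_atTop_sets.1 hs
  obtain ⟨v, hv, hvs⟩ := mem_comap.1 hs'
  obtain ⟨δ, hδ, hb⟩ := Metric.mem_nhds_iff.1 hv
  by_contra hne
  have hall : ∀ x, a ≤ x → δ ≤ |g x| := by
    intro x hx
    by_contra hlt
    push Not at hlt
    exact hne ⟨x, ha x hx, hvs (hb (by simpa using hlt))⟩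
  have hi : IntegrableOn g (Ioi (max a 0)) := hg.mono_set (Ioi_subset_Ioi (le_max_right _ _))
  have hc : IntegrableOn (fun _ : ℝ => δ) (Ioi (max a 0)) := by
    refine Integrable.mono hi aestronglyMeasurable_const ?_
    refine (ae_restrict_iff' measurableSet_Ioi).2 (Eventually.of_forall ?_)
    intro x hx
    rw [Real.norm_eq_abs, Real.norm_eq_abs, abs_of_pos hδ]
    exact hall x ((le_max_left _ _).trans (le_of_lt hx))
  rw [integrableOn_const_iff] at hc
  simp [hδ.ne'] at hc

/-- Differentiation under the integral sign on a compact interval. -/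
lemma deriv_int {e : ℝ × ℝ → ℝ} (he : ContDiff ℝ (⊤ : ℕ∞) e) (R s : ℝ) :
    HasDerivAt (fun s => ∫ x in (0 : ℝ)..R, e (x, s)) (∫ x in (0 : ℝ)..R, D2 e (x, s)) s := by
  have hc : Continuous e := he.continuous
  have hc2 : Continuous (D2 e) := (cd_D2 he).continuous
  obtain ⟨C, hC⟩ := (isCompact_uIcc.prod
    (isCompact_closedBall s 1) : IsCompact ((uIcc 0 R) ×ˢ (Metric.closedBall s 1))).exists_bound_of_continuousOn
      hc2.continuousOn
  refine (intervalIntegral.hasDerivAt_integral_of_dominated_loc_of_deriv_le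
    (F := fun s x => e (x, s)) (F' := fun s x => D2 e (x, s)) (bound := fun _ => C)
    (Metric.closedBall_mem_nhds s one_pos) ?_ ?_ ?_ ?_ ?_ ?_).2
  · exact Eventually.of_forall fun y => (by fun_prop : Continuous fun x => e (x, y)).aestronglyMeasurable
  · exact (by fun_prop : Continuous fun x => e (x, s)).intervalIntegrable _ _
  · exact (by fun_prop : Continuous fun x => D2 e (x, s)).aestronglyMeasurable
  · exact Eventually.of_forall fun x hx y hy => hC (x, y) ⟨uIoc_subset_uIcc hx, hy⟩
  · exact intervalIntegrable_const
  · exact Eventually.of_forall fun x hx y hy => hd2 he x y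

end KdVAux

open KdVAux in
theorem energy_time_derivative_right (u : ℝ → ℝ → ℝ) (I : Set ℝ)
    (hu : RightKdVSolution u I) (t : ℝ) (ht : t ∈ interior I) :
    HasDerivAt
      (fun s => ∫ x in Ioi (0 : ℝ),
        ((1 / 2) * (deriv (fun y => u y s) x) ^ 2 - (1 / 3) * (u x s) ^ 3))
      (-(deriv (fun s => u 0 s) t) * deriv (fun y => u y t) 0
        - (1 / 2) * (iteratedDeriv 2 (fun z => u z t) 0 + (u 0 t) ^ 2) ^ 2) t := by
  obtain ⟨U, hUdef⟩ : ∃ U : ℝ × ℝ → ℝ, U = Function.uncurry u := ⟨_, rfl⟩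
  have hU : ContDiff ℝ (⊤ : ℕ∞) U := hUdef ▸ hu.smooth
  have huU : ∀ x s, u x s = U (x, s) := fun x s => by rw [hUdef]; rfl
  have hU1 := cd_D1 hU
  have hU11 := cd_D1 hU1
  have hU2 := cd_D2 hU
  have i0 : ∀ s x, iteratedDeriv 0 (fun z => u z s) x = U (x, s) := by
    intro s x; simp [huU]
  have i1 : ∀ s, iteratedDeriv 1 (fun z => u z s) = fun x => D1 U (x, s) := by
    intro s; ext x; simp only [iteratedDeriv_one, huU]; exact (hd1 hU x s).deriv
  have i2 : ∀ s, iteratedDeriv 2 (fun z => u z s) = fun x => D1 (D1 U) (x, s) := by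
    intro s; rw [iteratedDeriv_succ, i1]; ext x; exact (hd1 hU1 x s).deriv
  have i3 : ∀ s, iteratedDeriv 3 (fun z => u z s) = fun x => D1 (D1 (D1 U)) (x, s) := by
    intro s; rw [iteratedDeriv_succ, i2]; ext x; exact (hd1 hU11 x s).deriv
  have d1 : ∀ s x, deriv (fun y => u y s) x = D1 U (x, s) := by
    intro s x; simp only [huU]; exact (hd1 hU x s).deriv
  have d2 : ∀ s x, deriv (fun s => u x s) s = D2 U (x, s) := by
    intro s x; simp only [huU]; exact (hd2 hU x s).deriv
  have eqn : ∀ x, 0 ≤ x → ∀ s ∈ I,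
      D2 U (x, s) = -(D1 (D1 (D1 U)) (x, s) + 2 * U (x, s) * D1 U (x, s)) := by
    intro x hx s hs
    have h := hu.eqn x hx s hs
    rw [d2, i2] at h
    simp only [huU] at h
    have h' := ((hd1 hU11 x s).fun_add ((hd1 hU x s).fun_pow 2)).deriv
    rw [h'] at h
    push_cast at h
    linear_combination h
  -- the flux
  let F : ℝ → ℝ → ℝ := fun x s =>
    D1 U (x, s) * D2 U (x, s) + (1 / 2) * (D1 (D1 U) (x, s) + U (x, s) ^ 2) ^ 2
  let e : ℝ × ℝ → ℝ := fun p => (1 / 2) * D1 U p ^ 2 - (1 / 3) * U p ^ 3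
  have he : ContDiff ℝ (⊤ : ℕ∞) e :=
    (contDiff_const.mul (hU1.pow 2)).sub (contDiff_const.mul (hU.pow 3))
  have he2 : ∀ x s, D2 e (x, s) = D1 U (x, s) * D2 (D1 U) (x, s) - U (x, s) ^ 2 * D2 U (x, s) := by
    intro x s
    have h := (((hd2 hU1 x s).fun_pow 2).const_mul (1 / 2 : ℝ)).fun_sub
      (((hd2 hU x s).fun_pow 3).const_mul (1 / 3 : ℝ))
    rw [(hd2 he x s).unique h]
    push_cast
    ring
  have hF : ∀ x, 0 ≤ x → ∀ s ∈ I, HasDerivAt (fun x => F x s) (D2 e (x, s)) x := by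
    intro x hx s hs
    have h := ((hd1 hU1 x s).fun_mul (hd1 hU2 x s)).fun_add
      ((((hd1 hU11 x s).fun_add ((hd1 hU x s).fun_pow 2)).fun_pow 2).const_mul (1 / 2 : ℝ))
    refine h.congr_deriv ?_
    rw [he2, comm12 hU, eqn x hx s hs]
    push_cast
    ring
  have hFint : ∀ R, 0 ≤ R → ∀ s ∈ I, ∫ x in (0 : ℝ)..R, D2 e (x, s) = F R s - F 0 s := by
    intro R hR s hs
    refine intervalIntegral.integral_eq_sub_of_hasDerivAt (f := fun x => F x s) ?_ ?_
    · intro x hx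
      rw [uIcc_of_le hR] at hx
      exact hF x hx.1 s hs
    · have hc2 : Continuous (D2 e) := (cd_D2 he).continuous
      exact (by fun_prop : Continuous fun x => D2 e (x, s)).intervalIntegrable _ _
  obtain ⟨ε, hε, g, hg, hbd⟩ := hu.locUnif t (interior_subset ht)
  have hne := neBot_aux hg
  obtain ⟨l, hl⟩ : ∃ l, l = atTop ⊓ comap g (nhds 0) := ⟨_, rfl⟩
  rw [← hl] at hne
  have hl1 : Tendsto id l atTop := by rw [hl]; exact tendsto_id.mono_left inf_le_left
  have hlg : Tendsto g l (nhds 0) := by rw [hl]; exact tendsto_comap.mono_left inf_le_right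
  have hpos : ∀ᶠ R in l, (0 : ℝ) < R := hl1.eventually (eventually_gt_atTop 0)
  let S : Set ℝ := interior I ∩ Metric.ball t ε
  have hSI : ∀ s ∈ S, s ∈ I := fun s hs => interior_subset hs.1
  have hSo : IsOpen S := isOpen_interior.inter Metric.isOpen_ball
  have hbound : ∀ s ∈ S, ∀ x, 0 < x → |U (x, s)| ≤ g x ∧ |D1 U (x, s)| ≤ g x ∧
      |D1 (D1 U) (x, s)| ≤ g x ∧ |D1 (D1 (D1 U)) (x, s)| ≤ g x := by
    intro s hs x hx
    have h := hbd s (hSI s hs) (by simpa [Real.dist_eq] using hs.2) x hx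
    have h0 := h 0 (by norm_num)
    have h1 := h 1 (by norm_num)
    have h2 := h 2 (by norm_num)
    have h3 := h 3 (by norm_num)
    rw [i0] at h0
    rw [i1] at h1
    rw [i2] at h2
    rw [i3] at h3
    refine ⟨?_, ?_, ?_, ?_⟩
    · nlinarith [sq_nonneg (U (x, s))]
    · nlinarith [sq_nonneg (D1 U (x, s))]
    · nlinarith [sq_nonneg (D1 (D1 U) (x, s))]
    · nlinarith [sq_nonneg (D1 (D1 (D1 U)) (x, s))]
  have hFb : ∀ s ∈ S, ∀ x, 0 < x →
      |F x s| ≤ g x * (g x + 2 * g x * g x) + (1 / 2) * (g x + g x ^ 2) ^ 2 := by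
    intro s hs x hx
    obtain ⟨b0, b1, b2, b3⟩ := hbound s hs x hx
    have hg0 : 0 ≤ g x := (abs_nonneg _).trans b0
    have bt : |D2 U (x, s)| ≤ g x + 2 * g x * g x := by
      rw [eqn x hx.le s (hSI s hs), abs_neg]
      refine (abs_add_le _ _).trans ?_
      rw [abs_mul, abs_mul, abs_two]
      gcongr
    refine (abs_add_le _ _).trans ?_
    rw [abs_mul, abs_mul, abs_pow, abs_of_pos (by norm_num : (0 : ℝ) < 1 / 2)]
    have b5 : |D1 (D1 U) (x, s) + U (x, s) ^ 2| ≤ g x + g x ^ 2 := by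
      refine (abs_add_le _ _).trans ?_
      rw [abs_pow]
      gcongr
    gcongr
  have hfin : HasDerivAt (fun s => ∫ x in Ioi (0 : ℝ), e (x, s)) ((fun s => -F 0 s) t) t := by
    refine hasDerivAt_of_tendstoUniformlyOn (l := l) (s := S)
      (f := fun R s => ∫ x in (0 : ℝ)..R, e (x, s)) (f' := fun R s => F R s - F 0 s)
      (g := fun s => ∫ x in Ioi (0 : ℝ), e (x, s)) (g' := fun s => -F 0 s)
      hSo ?_ ?_ ?_ ⟨ht, Metric.mem_ball_self hε⟩
    · rw [Metric.tendstoUniformlyOn_iff]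
      intro δ hδ
      have hlim : Tendsto (fun x => g x * (g x + 2 * g x * g x) + (1 / 2) * (g x + g x ^ 2) ^ 2)
          l (nhds 0) := by
        have hcont : Continuous fun q : ℝ => q * (q + 2 * q * q) + (1 / 2) * (q + q ^ 2) ^ 2 := by
          fun_prop
        have := (hcont.tendsto 0).comp hlg
        simpa [Function.comp_def] using this
      filter_upwards [hlim.eventually_lt_const hδ, hpos] with R h1 h2 s hs
      rw [Real.dist_eq]
      have := hFb s hs R h2
      rw [show -F 0 s - (F R s - F 0 s) = -F R s by ring, abs_neg]
      exact this.trans_lt h1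
    · filter_upwards [hpos] with R hR s hs
      rw [← hFint R hR.le s (hSI s hs)]
      exact deriv_int he R s
    · intro s hs
      refine (intervalIntegral_tendsto_integral_Ioi 0 ?_ tendsto_id).comp hl1
      have hc : Continuous e := he.continuous
      have hces : Continuous fun x => e (x, s) := by fun_prop
      have q0 := hu.int2 s (hSI s hs) 0 (by norm_num)
      have q1 := hu.int2 s (hSI s hs) 1 (by norm_num)
      have t0 := hu.decay s (hSI s hs) 0 (by norm_num)
      simp only [i0] at q0 t0
      simp only [i1] at q1
      refine IntegrableOn.mono_set (t := Ici 0) ?_ Ioi_subset_Ici_self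
      refine LocallyIntegrableOn.integrableOn_of_isBigO_atTop
        (g := fun x => U (x, s) ^ 2 + D1 U (x, s) ^ 2)
        (hces.locallyIntegrable.locallyIntegrableOn _) ?_ ⟨Ioi 0, Ioi_mem_atTop 0, q0.add q1⟩
      refine Asymptotics.IsBigO.of_bound 1 ?_
      have ta : ∀ᶠ x in atTop, |U (x, s)| < 1 := by
        have := t0.abs
        rw [abs_zero] at this
        exact this.eventually_lt_const one_pos
      filter_upwards [ta] with x hx
      rw [Real.norm_eq_abs, Real.norm_eq_abs, one_mul,
        abs_of_nonneg (by positivity : 0 ≤ U (x, s) ^ 2 + D1 U (x, s) ^ 2)]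
      obtain ⟨ha, hb⟩ := abs_lt.1 hx
      change |(1 / 2) * D1 U (x, s) ^ 2 - (1 / 3) * U (x, s) ^ 3| ≤ _
      rw [abs_le]
      have k1 : 0 ≤ U (x, s) ^ 2 * (1 - U (x, s)) := mul_nonneg (sq_nonneg _) (by linarith)
      have k2 : 0 ≤ U (x, s) ^ 2 * (1 + U (x, s)) := mul_nonneg (sq_nonneg _) (by linarith)
      constructor <;> nlinarith [sq_nonneg (U (x, s)), sq_nonneg (D1 U (x, s))]
  have hfun : (fun s => ∫ x in Ioi (0 : ℝ),
        ((1 / 2) * (deriv (fun y => u y s) x) ^ 2 - (1 / 3) * (u x s) ^ 3))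
      = fun s => ∫ x in Ioi (0 : ℝ), e (x, s) := by
    funext s
    simp only [d1]
    simp only [huU, e]
  rw [hfun]
  refine hfin.congr_deriv ?_
  rw [d1, d2, i2, huU]
  simp only [F]
  ring
end

section
/- Let u be a smooth decaying solution of KdV on the left half-line over a time interval I containing 0, with u(0,t) = 0 for all t ∈ I. Then for every t ∈ I, E[u](t) = E[u](0) + (1/2)∫₀^t (∂_x² u(0,s))² ds, where E[u](t) = ∫_{−∞}^0 ( (1/2)(∂_x u)²(x,t) − (1/3)u³(x,t) ) dx. -/
open MeasureTheory Set Filter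

/-- A smooth decaying solution of KdV `∂_t u + ∂_x(∂_x² u + u²) = 0` on the left
half-line `(-∞,0]`, over a time interval `I`: smooth, satisfying the equation for
`x ≤ 0`, `t ∈ I`, with `u(·,t)` and its `x`-derivatives up to order three
integrable and square integrable on `(-∞,0)` and tending to `0` as `x → -∞`,
these bounds being locally uniform in `t`. -/
structure LeftKdVSolution (u : ℝ → ℝ → ℝ) (I : Set ℝ) : Prop where
  smooth : ContDiff ℝ (⊤ : ℕ∞) (Function.uncurry u)
  eqn : ∀ x ∈ Iic (0 : ℝ), ∀ t ∈ I,
    deriv (fun s => u x s) t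
      + deriv (fun y => iteratedDeriv 2 (fun z => u z t) y + (u y t) ^ 2) x = 0
  decay : ∀ t ∈ I, ∀ n ≤ 3,
    Tendsto (fun x => iteratedDeriv n (fun z => u z t) x) atBot (nhds 0)
  int1 : ∀ t ∈ I, ∀ n ≤ 3,
    IntegrableOn (fun x => iteratedDeriv n (fun z => u z t) x) (Iio 0)
  int2 : ∀ t ∈ I, ∀ n ≤ 3,
    IntegrableOn (fun x => (iteratedDeriv n (fun z => u z t) x) ^ 2) (Iio 0)
  locUnif : ∀ t ∈ I, ∃ ε > 0, ∃ g : ℝ → ℝ, IntegrableOn g (Iio 0) ∧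
    ∀ s ∈ I, |s - t| < ε → ∀ x ∈ Iio (0 : ℝ), ∀ n ≤ 3,
      |iteratedDeriv n (fun z => u z s) x| + (iteratedDeriv n (fun z => u z s) x) ^ 2 ≤ g x

namespace KdVLeft

/-- partial derivative in `x` -/
noncomputable def D1 (v : ℝ → ℝ → ℝ) : ℝ → ℝ → ℝ := fun x t => deriv (fun y => v y t) x
/-- partial derivative in `t` -/
noncomputable def D2 (v : ℝ → ℝ → ℝ) : ℝ → ℝ → ℝ := fun x t => deriv (fun s => v x s) t

/-- jointly smooth -/
def Sm (v : ℝ → ℝ → ℝ) : Prop := ContDiff ℝ (⊤ : ℕ∞) (Function.uncurry v)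

lemma Sm.fd {v : ℝ → ℝ → ℝ} (h : Sm v) (p : ℝ × ℝ) :
    HasFDerivAt (Function.uncurry v) (fderiv ℝ (Function.uncurry v) p) p :=
  ((ContDiff.differentiable h (by simp)) p).hasFDerivAt

lemma Sm.h1' {v : ℝ → ℝ → ℝ} (h : Sm v) (x t : ℝ) :
    HasDerivAt (fun y => v y t) (fderiv ℝ (Function.uncurry v) (x, t) (1, 0)) x :=
  (h.fd (x, t)).comp_hasDerivAt (f := fun y : ℝ => (y, t)) x ((hasDerivAt_id x).prodMk (hasDerivAt_const x t))

lemma Sm.h2' {v : ℝ → ℝ → ℝ} (h : Sm v) (x t : ℝ) :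
    HasDerivAt (fun s => v x s) (fderiv ℝ (Function.uncurry v) (x, t) (0, 1)) t :=
  (h.fd (x, t)).comp_hasDerivAt (f := fun y : ℝ => (x, y)) t ((hasDerivAt_const t x).prodMk (hasDerivAt_id t))

lemma Sm.e1 {v : ℝ → ℝ → ℝ} (h : Sm v) :
    Function.uncurry (D1 v) = fun p => fderiv ℝ (Function.uncurry v) p (1, 0) := by
  funext ⟨x, t⟩
  exact (h.h1' x t).deriv

lemma Sm.e2 {v : ℝ → ℝ → ℝ} (h : Sm v) :
    Function.uncurry (D2 v) = fun p => fderiv ℝ (Function.uncurry v) p (0, 1) := by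
  funext ⟨x, t⟩
  exact (h.h2' x t).deriv

lemma Sm.fdsm {v : ℝ → ℝ → ℝ} (h : Sm v) :
    ContDiff ℝ (⊤ : ℕ∞) (fderiv ℝ (Function.uncurry v)) :=
  ContDiff.fderiv_right h (by simp)

lemma Sm.d1 {v : ℝ → ℝ → ℝ} (h : Sm v) : Sm (D1 v) := by
  unfold Sm
  rw [h.e1]
  exact h.fdsm.clm_apply contDiff_const

lemma Sm.d2 {v : ℝ → ℝ → ℝ} (h : Sm v) : Sm (D2 v) := by
  unfold Sm
  rw [h.e2]
  exact h.fdsm.clm_apply contDiff_const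

lemma Sm.h1 {v : ℝ → ℝ → ℝ} (h : Sm v) (x t : ℝ) :
    HasDerivAt (fun y => v y t) (D1 v x t) x :=
  (h.h1' x t).differentiableAt.hasDerivAt

lemma Sm.h2 {v : ℝ → ℝ → ℝ} (h : Sm v) (x t : ℝ) :
    HasDerivAt (fun s => v x s) (D2 v x t) t :=
  (h.h2' x t).differentiableAt.hasDerivAt

lemma Sm.cont {v : ℝ → ℝ → ℝ} (h : Sm v) : Continuous (fun p : ℝ × ℝ => v p.1 p.2) :=
  ContDiff.continuous h

lemma Sm.comm {v : ℝ → ℝ → ℝ} (h : Sm v) (x t : ℝ) : D1 (D2 v) x t = D2 (D1 v) x t := by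
  have hd := ((h.fdsm.differentiable (by simp)) (x, t)).hasFDerivAt
  have a := (h.d2.h1' x t).deriv
  have b := (h.d1.h2' x t).deriv
  have c1 : fderiv ℝ (fun p => fderiv ℝ (Function.uncurry v) p (0, 1)) (x, t)
      = _ := (hd.clm_apply (hasFDerivAt_const ((0 : ℝ), (1 : ℝ)) (x, t))).fderiv
  have c2 : fderiv ℝ (fun p => fderiv ℝ (Function.uncurry v) p (1, 0)) (x, t)
      = _ := (hd.clm_apply (hasFDerivAt_const ((1 : ℝ), (0 : ℝ)) (x, t))).fderiv
  rw [h.e2, c1] at a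
  rw [h.e1, c2] at b
  have sy := (ContDiff.contDiffAt h (x := (x, t))).isSymmSndFDerivAt
    (by simp; exact WithTop.coe_le_coe.2 (le_top : (2 : ℕ∞) ≤ ⊤))
  have := sy (1, 0) (0, 1)
  change deriv _ _ = deriv _ _
  rw [a, b]
  simpa using this

lemma exists_bound {u : ℝ → ℝ → ℝ} {I : Set ℝ} (hu : LeftKdVSolution u I) {K : Set ℝ}
    (hK : IsCompact K) (hKI : K ⊆ I) : ∃ g : ℝ → ℝ, IntegrableOn g (Iio 0) ∧
    ∀ s ∈ K, ∀ x ∈ Iio (0 : ℝ), ∀ n ≤ 3, |iteratedDeriv n (fun z => u z s) x| ≤ g x := by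
  refine hK.induction_on (p := fun S => ∃ g : ℝ → ℝ, IntegrableOn g (Iio 0) ∧
    ∀ s ∈ S, ∀ x ∈ Iio (0 : ℝ), ∀ n ≤ 3, |iteratedDeriv n (fun z => u z s) x| ≤ g x) ?_ ?_ ?_ ?_
  · exact ⟨0, integrableOn_zero, by simp⟩
  · rintro s t hst ⟨g, hg, h⟩
    exact ⟨g, hg, fun a ha => h a (hst ha)⟩
  · rintro s t ⟨g, hg, h⟩ ⟨g', hg', h'⟩
    refine ⟨fun x => |g x| + |g' x|, hg.abs.add hg'.abs, ?_⟩
    rintro a (ha | ha) x hx n hn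
    · have := h a ha x hx n hn
      linarith [le_abs_self (g x), abs_nonneg (g' x)]
    · have := h' a ha x hx n hn
      linarith [le_abs_self (g' x), abs_nonneg (g x)]
  · intro t ht
    obtain ⟨ε, hε, g, hg, h⟩ := hu.locUnif t (hKI ht)
    refine ⟨K ∩ Metric.ball t ε, ?_, g, hg, ?_⟩
    · exact inter_mem self_mem_nhdsWithin (mem_nhdsWithin_of_mem_nhds (Metric.ball_mem_nhds t hε))
    · rintro s ⟨hs, hs'⟩ x hx n hn
      have := h s (hKI hs) (by simpa [Real.dist_eq] using hs') x hx n hn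
      nlinarith [sq_nonneg (iteratedDeriv n (fun z => u z s) x)]

lemma frequently_small {g : ℝ → ℝ} (hg : IntegrableOn g (Iio 0)) {δ : ℝ} (hδ : 0 < δ) :
    ∃ᶠ R in atBot, g R < δ := by
  intro hcon
  obtain ⟨a, ha⟩ := eventually_atBot.1 hcon
  have h1 : IntegrableOn g (Iio (min a 0)) := hg.mono_set (Iio_subset_Iio (min_le_right _ _))
  have h2 : IntegrableOn (fun _ : ℝ => δ) (Iio (min a 0)) := by
    refine Integrable.mono' h1 (by fun_prop) ?_
    refine (ae_restrict_iff' measurableSet_Iio).2 (Eventually.of_forall fun x hx => ?_)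
    have := ha x (le_of_lt (lt_of_lt_of_le hx (min_le_left _ _)))
    rw [Real.norm_of_nonneg hδ.le]
    linarith
  rw [integrableOn_const_iff] at h2
  rcases h2 with h2 | h2
  · simp at h2
    exact hδ.ne' h2
  · simp at h2

/-- energy density -/
noncomputable def en (u : ℝ → ℝ → ℝ) (x t : ℝ) : ℝ :=
  (1 / 2) * (D1 u x t) ^ 2 - (1 / 3) * (u x t) ^ 3
/-- its time derivative -/
noncomputable def ent (u : ℝ → ℝ → ℝ) (x t : ℝ) : ℝ :=
  D1 u x t * D2 (D1 u) x t - (u x t) ^ 2 * D2 u x t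
/-- the flux -/
noncomputable def fl (u : ℝ → ℝ → ℝ) (x t : ℝ) : ℝ :=
  D1 u x t * D2 u x t + (1 / 2) * (D1 (D1 u) x t + (u x t) ^ 2) ^ 2

lemma it2 (u : ℝ → ℝ → ℝ) (x t : ℝ) : iteratedDeriv 2 (fun z => u z t) x = D1 (D1 u) x t := by
  rw [iteratedDeriv_succ, iteratedDeriv_one]; rfl

lemma it3 (u : ℝ → ℝ → ℝ) (x t : ℝ) :
    iteratedDeriv 3 (fun z => u z t) x = D1 (D1 (D1 u)) x t := by
  rw [iteratedDeriv_succ, iteratedDeriv_succ, iteratedDeriv_one]; rfl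

lemma it1 (u : ℝ → ℝ → ℝ) (x t : ℝ) : iteratedDeriv 1 (fun z => u z t) x = D1 u x t := by
  rw [iteratedDeriv_one]; rfl

lemma kdv {u : ℝ → ℝ → ℝ} {I : Set ℝ} (hu : LeftKdVSolution u I) {x t : ℝ} (hx : x ≤ 0)
    (ht : t ∈ I) : D2 u x t = -(D1 (D1 (D1 u)) x t + 2 * u x t * D1 u x t) := by
  have hs : Sm u := hu.smooth
  have := hu.eqn x hx t ht
  simp only [it2] at this
  have h := ((hs.d1.d1.h1 x t).add ((hs.h1 x t).pow 2)).deriv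
  have h' : deriv (fun y => D1 (D1 u) y t + u y t ^ 2) x = _ := h
  rw [h'] at this
  change D2 u x t + _ = 0 at this
  simp at this
  linarith

lemma en_deriv {u : ℝ → ℝ → ℝ} (hs : Sm u) (x t : ℝ) :
    HasDerivAt (fun s => en u x s) (ent u x t) t := by
  have h := (((hs.d1.h2 x t).pow 2).const_mul (1 / 2)).sub (((hs.h2 x t).pow 3).const_mul (1 / 3))
  refine h.congr_deriv ?_
  simp [ent]
  ring

lemma fl_deriv {u : ℝ → ℝ → ℝ} {I : Set ℝ} (hu : LeftKdVSolution u I) {x t : ℝ} (hx : x ≤ 0)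
    (ht : t ∈ I) : HasDerivAt (fun y => fl u y t) (ent u x t) x := by
  have hs : Sm u := hu.smooth
  have h := ((hs.d1.h1 x t).mul (hs.d2.h1 x t)).add
    ((((hs.d1.d1.h1 x t).add ((hs.h1 x t).pow 2)).pow 2).const_mul (1 / 2))
  refine h.congr_deriv ?_
  have hk := kdv hu hx ht
  have : D1 (D1 (D1 u)) x t = - D2 u x t - 2 * u x t * D1 u x t := by linarith
  simp [ent, hs.comm, this]
  ring

lemma ent_cont {u : ℝ → ℝ → ℝ} (hs : Sm u) : Continuous (fun p : ℝ × ℝ => ent u p.1 p.2) := by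
  have := hs.cont
  have := hs.d1.cont
  have := hs.d2.cont
  have := hs.d1.d2.cont
  unfold ent
  fun_prop

lemma en_cont {u : ℝ → ℝ → ℝ} (hs : Sm u) : Continuous (fun p : ℝ × ℝ => en u p.1 p.2) := by
  have := hs.cont
  have := hs.d1.cont
  unfold en
  fun_prop

lemma fl_cont {u : ℝ → ℝ → ℝ} (hs : Sm u) : Continuous (fun p : ℝ × ℝ => fl u p.1 p.2) := by
  have := hs.cont
  have := hs.d1.cont
  have := hs.d2.cont
  have := hs.d1.d1.cont
  unfold fl
  fun_prop

lemma c1 {f : ℝ → ℝ → ℝ} (h : Continuous (fun p : ℝ × ℝ => f p.1 p.2)) (t : ℝ) :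
    Continuous (fun x => f x t) :=
  h.comp (by fun_prop : Continuous fun x : ℝ => (x, t))

lemma c2 {f : ℝ → ℝ → ℝ} (h : Continuous (fun p : ℝ × ℝ => f p.1 p.2)) (x : ℝ) :
    Continuous (fun t => f x t) :=
  h.comp (by fun_prop : Continuous fun t : ℝ => (x, t))

lemma local_identity {u : ℝ → ℝ → ℝ} {I : Set ℝ} (hu : LeftKdVSolution u I) {t R : ℝ}
    (hR : R ≤ 0) (hI : uIcc 0 t ⊆ I) :
    (∫ x in R..0, en u x t) - (∫ x in R..0, en u x 0)
      = (∫ s in (0 : ℝ)..t, fl u 0 s) - ∫ s in (0 : ℝ)..t, fl u R s := by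
  have hs : Sm u := hu.smooth
  rw [← intervalIntegral.integral_sub ((c1 (en_cont hs) t).intervalIntegrable _ _)
    ((c1 (en_cont hs) 0).intervalIntegrable _ _),
    ← intervalIntegral.integral_sub ((c2 (fl_cont hs) 0).intervalIntegrable _ _)
    ((c2 (fl_cont hs) R).intervalIntegrable _ _)]
  have e1 : ∀ x, en u x t - en u x 0 = ∫ s in (0 : ℝ)..t, ent u x s := fun x =>
    (intervalIntegral.integral_eq_sub_of_hasDerivAt (fun s _ => en_deriv hs x s)
      ((c2 (ent_cont hs) x).intervalIntegrable _ _)).symm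
  simp_rw [e1]
  rw [intervalIntegral_intervalIntegral_swap]
  · apply intervalIntegral.integral_congr
    intro s hs'
    apply intervalIntegral.integral_eq_sub_of_hasDerivAt (f := fun y => fl u y s)
    · intro x hx
      rw [uIcc_of_le hR] at hx
      exact fl_deriv hu hx.2 (hI hs')
    · exact (c1 (ent_cont hs) s).intervalIntegrable _ _
  · have : IntegrableOn (Function.uncurry (ent u)) (uIcc R 0 ×ˢ uIcc 0 t) :=
      (ent_cont hs).continuousOn.integrableOn_compact (isCompact_uIcc.prod isCompact_uIcc)
    exact this.mono_set (prod_mono uIoc_subset_uIcc uIoc_subset_uIcc)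

lemma en_int {u : ℝ → ℝ → ℝ} {I : Set ℝ} (hu : LeftKdVSolution u I) {t : ℝ} (ht : t ∈ I) :
    IntegrableOn (fun x => en u x t) (Iic 0) := by
  have hs : Sm u := hu.smooth
  have a := hu.int2 t ht 1 (by norm_num)
  have b := hu.int2 t ht 0 (by norm_num)
  have d := hu.decay t ht 0 (by norm_num)
  simp only [it1, iteratedDeriv_zero] at a b d
  rw [← integrableOn_Iic_iff_integrableOn_Iio] at a b
  refine (a.const_mul (1 / 2)).sub (Integrable.const_mul ?_ (1 / 3))
  refine LocallyIntegrableOn.integrableOn_of_isBigO_atBot (g := fun x => u x t ^ 2) ?_ ?_ ?_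
  · exact (((c1 hs.cont t).pow 3).locallyIntegrable).locallyIntegrableOn _
  · have h1 : (fun x => u x t) =O[atBot] (fun _ => (1 : ℝ)) := d.isBigO_one ℝ
    have := h1.mul (Asymptotics.isBigO_refl (fun x => u x t ^ 2) atBot)
    refine this.congr (fun x => ?_) (fun x => ?_) <;> ring
  · exact ⟨Iic 0, Iic_mem_atBot 0, b⟩

lemma fl_zero {u : ℝ → ℝ → ℝ} {I : Set ℝ} (hbc : ∀ t ∈ I, u 0 t = 0) {t : ℝ}
    (hI : uIcc 0 t ⊆ I) : (∫ s in (0 : ℝ)..t, fl u 0 s)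
      = (1 / 2) * ∫ s in (0 : ℝ)..t, (iteratedDeriv 2 (fun z => u z s) 0) ^ 2 := by
  rw [← intervalIntegral.integral_const_mul]
  apply intervalIntegral.integral_congr_uIoo
  intro s hs
  have h1 : D2 u 0 s = 0 := by
    have : (fun r => u 0 r) =ᶠ[nhds s] fun _ => (0 : ℝ) := by
      filter_upwards [isOpen_Ioo.mem_nhds hs] with r hr
      exact hbc r (hI (Ioo_subset_Icc_self hr))
    change deriv _ _ = 0
    rw [this.deriv_eq]
    simp
  have h2 : u 0 s = 0 := hbc s (hI (Ioo_subset_Icc_self hs))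
  simp [fl, h1, h2, it2]

lemma fl_small {u : ℝ → ℝ → ℝ} {I : Set ℝ} (hu : LeftKdVSolution u I) {s R γ δ : ℝ}
    (hR : R < 0) (hs : s ∈ I) (hδ : γ < δ) (hδ1 : δ < 1)
    (hb : ∀ n ≤ 3, |iteratedDeriv n (fun z => u z s) R| ≤ γ) : |fl u R s| ≤ 5 * δ := by
  have a0 := hb 0 (by norm_num)
  have a1 := hb 1 (by norm_num)
  have a2 := hb 2 (by norm_num)
  have a3 := hb 3 (by norm_num)
  rw [it1] at a1
  rw [it2] at a2
  rw [it3] at a3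
  rw [iteratedDeriv_zero] at a0
  unfold fl
  rw [kdv hu hR.le hs]
  generalize u R s = p at *
  generalize D1 (D1 (D1 u)) R s = w at *
  generalize D1 (D1 u) R s = r at *
  generalize D1 u R s = q at *
  have g0 : 0 ≤ γ := (abs_nonneg _).trans a0
  have d0 : 0 < δ := by linarith
  have gg : γ * γ ≤ δ := by nlinarith
  have ggg : γ * γ * γ ≤ δ := by nlinarith
  have b1 : |q * w| ≤ δ := by
    rw [abs_mul]; exact (mul_le_mul a1 a3 (abs_nonneg _) g0).trans gg
  have b2 : |p * q * q| ≤ δ := by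
    rw [abs_mul, abs_mul]
    exact (mul_le_mul (mul_le_mul a0 a1 (abs_nonneg _) g0) a1 (abs_nonneg _)
      (by positivity)).trans ggg
  have p2 : p ^ 2 ≤ γ := by
    rw [← sq_abs]; nlinarith [abs_nonneg p]
  have b3 : |r + p ^ 2| ≤ 2 * γ := by
    have := abs_add_le r (p ^ 2)
    rw [abs_of_nonneg (sq_nonneg p)] at this
    linarith
  have b4 : (r + p ^ 2) ^ 2 ≤ 4 * δ := by
    rw [← sq_abs]; nlinarith [abs_nonneg (r + p ^ 2)]
  have b5 := sq_nonneg (r + p ^ 2)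
  rw [abs_le] at b1 b2 ⊢
  constructor <;> nlinarith

end KdVLeft

open KdVLeft

theorem energy_identity_left (u : ℝ → ℝ → ℝ) (I : Set ℝ) (hI : I.OrdConnected)
    (h0 : (0 : ℝ) ∈ I) (hu : LeftKdVSolution u I)
    (hbc : ∀ t ∈ I, u 0 t = 0) (t : ℝ) (ht : t ∈ I) :
    (∫ x in Iio (0 : ℝ),
        ((1 / 2) * (deriv (fun y => u y t) x) ^ 2 - (1 / 3) * (u x t) ^ 3))
      = (∫ x in Iio (0 : ℝ),
          ((1 / 2) * (deriv (fun y => u y 0) x) ^ 2 - (1 / 3) * (u x 0) ^ 3))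
        + (1 / 2) * ∫ s in (0 : ℝ)..t, (iteratedDeriv 2 (fun z => u z s) 0) ^ 2 := by
  have hsub : uIcc 0 t ⊆ I := hI.uIcc_subset h0 ht
  have hs : Sm u := hu.smooth
  obtain ⟨g, hg, hgb⟩ := exists_bound hu isCompact_uIcc hsub
  rw [← fl_zero hbc hsub]
  change (∫ x in Iio (0 : ℝ), en u x t) = (∫ x in Iio (0 : ℝ), en u x 0) + _
  rw [← integral_Iic_eq_integral_Iio, ← integral_Iic_eq_integral_Iio]
  have T1 := intervalIntegral_tendsto_integral_Iic 0 (en_int hu ht) tendsto_id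
  have T0 := intervalIntegral_tendsto_integral_Iic 0 (en_int hu h0) tendsto_id
  have T := ((T1.sub T0).sub_const (∫ s in (0 : ℝ)..t, fl u 0 s)).abs
  have key : ∀ δ : ℝ, 0 < δ → δ < 1 →
      |(∫ x in Iic (0 : ℝ), en u x t) - (∫ x in Iic (0 : ℝ), en u x 0)
        - ∫ s in (0 : ℝ)..t, fl u 0 s| ≤ 5 * δ * |t| := by
    intro δ hδ hδ1
    refine (isClosed_Iic (a := 5 * δ * |t|)).mem_of_frequently_of_tendsto ?_ T
    refine ((frequently_small hg hδ).and_eventually (eventually_lt_atBot (0 : ℝ))).mono ?_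
    rintro R ⟨hR, hR0⟩
    simp only [id, mem_Iic]
    rw [local_identity hu hR0.le hsub, sub_sub_cancel_left, abs_neg, ← Real.norm_eq_abs]
    have := intervalIntegral.norm_integral_le_of_norm_le_const (a := 0) (b := t)
      (f := fun s => fl u R s) (C := 5 * δ) (fun s hs' =>
        fl_small hu hR0 (hsub (uIoc_subset_uIcc hs')) hR hδ1
          (fun n hn => hgb s (uIoc_subset_uIcc hs') R hR0 n hn))
    simpa using this
  have lim : Tendsto (fun δ : ℝ => 5 * δ * |t|) (nhdsWithin 0 (Ioi 0)) (nhds 0) := by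
    have : Continuous (fun δ : ℝ => 5 * δ * |t|) := by fun_prop
    simpa using (this.tendsto 0).mono_left nhdsWithin_le_nhds
  have fin := ge_of_tendsto lim (by
    filter_upwards [Ioo_mem_nhdsGT (zero_lt_one' ℝ)] with δ hδ using key δ hδ.1 hδ.2)
  have := abs_nonpos_iff.1 fin
  linarith
end

section
/- (Lemma 3.2) Let T > 0 and let u be a smooth decaying solution of KdV on the left half-line over [−T,0], with u(0,t) = 0 for all t ∈ [−T,0]. Then for every t ∈ [−T,0], M[u](t) ≤ M[u](0) and E[u](t) ≤ E[u](0), where M[u](t) = (1/2)∫_{−∞}^0 u²(x,t) dx and E[u](t) = ∫_{−∞}^0 ( (1/2)(∂_x u)²(x,t) − (1/3)u³(x,t) ) dx. -/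
open MeasureTheory Set Filter

open Topology

noncomputable def kdvDx (V : ℝ × ℝ → ℝ) (p : ℝ × ℝ) : ℝ := fderiv ℝ V p (1, 0)
noncomputable def kdvDt (V : ℝ × ℝ → ℝ) (p : ℝ × ℝ) : ℝ := fderiv ℝ V p (0, 1)

lemma kdvDx_smooth {V : ℝ × ℝ → ℝ} (hV : ContDiff ℝ (⊤ : ℕ∞) V) :
    ContDiff ℝ (⊤ : ℕ∞) (kdvDx V) := by
  have h : ContDiff ℝ (⊤ : ℕ∞) (fderiv ℝ V) := hV.fderiv_right (by simp)
  exact h.clm_apply contDiff_const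

lemma kdvDt_smooth {V : ℝ × ℝ → ℝ} (hV : ContDiff ℝ (⊤ : ℕ∞) V) :
    ContDiff ℝ (⊤ : ℕ∞) (kdvDt V) := by
  have h : ContDiff ℝ (⊤ : ℕ∞) (fderiv ℝ V) := hV.fderiv_right (by simp)
  exact h.clm_apply contDiff_const

lemma kdvDx_hasDeriv {V : ℝ × ℝ → ℝ} (hV : ContDiff ℝ (⊤ : ℕ∞) V) (x t : ℝ) :
    HasDerivAt (fun y => V (y, t)) (kdvDx V (x, t)) x := by
  have h : HasFDerivAt V (fderiv ℝ V (x, t)) (x, t) :=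
    (hV.differentiable (by simp) _).hasFDerivAt
  exact h.comp_hasDerivAt x ((hasDerivAt_id x).prodMk (hasDerivAt_const x t))

lemma kdvDt_hasDeriv {V : ℝ × ℝ → ℝ} (hV : ContDiff ℝ (⊤ : ℕ∞) V) (x t : ℝ) :
    HasDerivAt (fun s => V (x, s)) (kdvDt V (x, t)) t := by
  have h : HasFDerivAt V (fderiv ℝ V (x, t)) (x, t) :=
    (hV.differentiable (by simp) _).hasFDerivAt
  exact h.comp_hasDerivAt t ((hasDerivAt_const t x).prodMk (hasDerivAt_id t))

lemma kdvD_comm {V : ℝ × ℝ → ℝ} (hV : ContDiff ℝ (⊤ : ℕ∞) V) (p : ℝ × ℝ) :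
    kdvDt (kdvDx V) p = kdvDx (kdvDt V) p := by
  have h : ContDiff ℝ (⊤ : ℕ∞) (fderiv ℝ V) := hV.fderiv_right (by simp)
  have hd : DifferentiableAt ℝ (fderiv ℝ V) p := h.differentiable (by simp) _
  have key : ∀ v w : ℝ × ℝ, fderiv ℝ (fun p => fderiv ℝ V p v) p w
      = fderiv ℝ (fderiv ℝ V) p w v := by
    intro v w
    rw [fderiv_clm_apply hd (differentiableAt_const v)]
    simp
  have hs : IsSymmSndFDerivAt ℝ V p := hV.contDiffAt.isSymmSndFDerivAt (by
    rw [minSmoothness_of_isRCLikeNormedField]; exact WithTop.coe_le_coe.2 le_top)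
  unfold kdvDt kdvDx
  rw [key, key]
  exact hs _ _

lemma kdv_iter {u : ℝ → ℝ → ℝ} (hu : ContDiff ℝ (⊤ : ℕ∞) (Function.uncurry u)) (n : ℕ) :
    ContDiff ℝ (⊤ : ℕ∞) (kdvDx^[n] (Function.uncurry u)) ∧
    ∀ t, iteratedDeriv n (fun z => u z t) = fun x => kdvDx^[n] (Function.uncurry u) (x, t) := by
  induction n with
  | zero => exact ⟨hu, fun t => by ext x; simp [Function.uncurry]⟩
  | succ n ih =>
    rw [Function.iterate_succ_apply']
    refine ⟨kdvDx_smooth ih.1, fun t => ?_⟩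
    rw [iteratedDeriv_succ, ih.2 t]
    ext x
    exact (kdvDx_hasDeriv ih.1 x t).deriv

lemma kdv_core (T t : ℝ) (ht : t ∈ Icc (-T) (0 : ℝ)) (e F q : ℝ → ℝ → ℝ)
    (he : ∀ x s, HasDerivAt (fun s => e x s) (q x s) s)
    (hF : ∀ x ≤ 0, ∀ s ∈ Icc (-T) (0:ℝ), HasDerivAt (fun y => F y s) (q x s) x)
    (hq : Continuous (Function.uncurry q))
    (hec : ∀ s, Continuous (fun x => e x s))
    (hei : ∀ s ∈ Icc (-T) (0:ℝ), IntegrableOn (fun x => e x s) (Iio 0))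
    (hfl : ∀ δ : ℝ, 0 < δ → δ ≤ 1 →
      ∃ᶠ R in atBot, ∀ s ∈ Icc (-T) (0:ℝ), -(5 * δ) ≤ F 0 s - F R s) :
    ∫ x in Iio (0:ℝ), e x t ≤ ∫ x in Iio (0:ℝ), e x 0 := by
  have h0T : (0:ℝ) ∈ Icc (-T) (0:ℝ) := ⟨ht.1.trans ht.2, le_rfl⟩
  have hsub : Icc t 0 ⊆ Icc (-T) (0:ℝ) := Icc_subset_Icc_left ht.1
  have hlim : ∀ s ∈ Icc (-T) (0:ℝ), Tendsto (fun R => ∫ x in R..0, e x s) atBot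
      (𝓝 (∫ x in Iio (0:ℝ), e x s)) := by
    intro s hs
    rw [← integral_Iic_eq_integral_Iio]
    exact intervalIntegral_tendsto_integral_Iic 0
      ((integrableOn_Iic_iff_integrableOn_Iio (by simp)).2 (hei s hs)) tendsto_id
  have hL := (hlim 0 h0T).sub (hlim t ht)
  have hid : ∀ R ≤ 0, (∫ x in R..0, e x 0) - ∫ x in R..0, e x t
      = ∫ s in t..0, ∫ x in R..0, q x s := by
    intro R hR
    rw [← intervalIntegral.integral_sub ((hec 0).intervalIntegrable _ _)
      ((hec t).intervalIntegrable _ _), ← intervalIntegral_intervalIntegral_swap]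
    · apply intervalIntegral.integral_congr
      intro x _
      refine (intervalIntegral.integral_eq_sub_of_hasDerivAt (fun s _ => he x s) ?_).symm
      exact (hq.comp (Continuous.prodMk_right x)).intervalIntegrable _ _
    · refine (hq.continuousOn.integrableOn_compact
        (isCompact_uIcc.prod isCompact_uIcc)).mono_set
        (prod_mono uIoc_subset_uIcc uIoc_subset_uIcc)
  by_contra hcon
  push Not at hcon
  set L := (∫ x in Iio (0:ℝ), e x 0) - ∫ x in Iio (0:ℝ), e x t with hLdef
  have hLneg : L < 0 := by rw [hLdef]; linarith
  have hev : ∀ᶠ R in atBot, (∫ x in R..0, e x 0) - ∫ x in R..0, e x t < L / 2 :=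
    hL.eventually (gt_mem_nhds (by linarith))
  have htT : 0 ≤ -t := by linarith [ht.2]
  obtain ⟨δ, hδ0, hδ1, hδ⟩ : ∃ δ : ℝ, 0 < δ ∧ δ ≤ 1 ∧ 5 * δ * (-t) ≤ -(L/2) := by
    refine ⟨min 1 (-L / (10 * (-t + 1))), lt_min one_pos (by apply div_pos <;> linarith),
      min_le_left _ _, ?_⟩
    have h1 : min 1 (-L / (10 * (-t + 1))) ≤ -L / (10 * (-t + 1)) := min_le_right _ _
    rw [le_div_iff₀ (by linarith)] at h1
    have h2 : 0 < min 1 (-L / (10 * (-t + 1))) :=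
      lt_min one_pos (by apply div_pos <;> linarith)
    nlinarith
  obtain ⟨R, hR1, hR2, hR0⟩ := ((hfl δ hδ0 hδ1).and_eventually
    (hev.and (eventually_le_atBot 0))).exists
  rw [hid R hR0] at hR2
  have hcont : Continuous (fun s => ∫ x in R..0, q x s) :=
    intervalIntegral.continuous_parametric_intervalIntegral_of_continuous'
      (f := fun s x => q x s) (hq.comp continuous_swap) R 0
  have hlow : ∫ s in t..0, (-(5 * δ)) ≤ ∫ s in t..0, ∫ x in R..0, q x s := by
    apply intervalIntegral.integral_mono_on ht.2 (by simp) (hcont.intervalIntegrable _ _)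
    intro s hs
    rw [intervalIntegral.integral_eq_sub_of_hasDerivAt (f := fun y => F y s)
      (fun x hx => hF x ?_ s (hsub hs))]
    · exact hR1 s (hsub hs)
    · exact (hq.comp (Continuous.prodMk_left s)).intervalIntegrable _ _
    · rw [uIcc_of_le hR0] at hx; exact hx.2
  simp at hlow
  linarith

lemma kdv_small {T : ℝ} {u : ℝ → ℝ → ℝ} (hu : LeftKdVSolution u (Icc (-T) 0)) (δ : ℝ)
    (hδ : 0 < δ) : ∃ᶠ R in atBot, R < 0 ∧ ∀ s ∈ Icc (-T) (0:ℝ), ∀ n ≤ 3,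
      |iteratedDeriv n (fun z => u z s) R| ≤ δ := by
  have hG : ∃ g : ℝ → ℝ, IntegrableOn g (Iio 0) ∧ ∀ s ∈ Icc (-T) (0:ℝ),
      s ∈ Icc (-T) (0:ℝ) → ∀ x ∈ Iio (0 : ℝ), ∀ n ≤ 3,
      |iteratedDeriv n (fun z => u z s) x| ≤ |g x| := by
    apply (isCompact_Icc (a := -T) (b := (0:ℝ))).induction_on
      (p := fun S => ∃ g : ℝ → ℝ, IntegrableOn g (Iio 0) volume ∧ ∀ s ∈ S,
        s ∈ Icc (-T) (0:ℝ) → ∀ x ∈ Iio (0 : ℝ), ∀ n ≤ 3,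
        |iteratedDeriv n (fun z => u z s) x| ≤ |g x|)
    · exact ⟨0, integrableOn_zero, by simp⟩
    · rintro A B hAB ⟨g, hg, h⟩
      exact ⟨g, hg, fun s hs => h s (hAB hs)⟩
    · rintro A B ⟨g, hg, h⟩ ⟨g', hg', h'⟩
      refine ⟨fun x => |g x| + |g' x|, hg.abs.add hg'.abs, ?_⟩
      rintro s (hs | hs) hsI x hx n hn
      · exact (h s hs hsI x hx n hn).trans
          (le_trans (by linarith [abs_nonneg (g' x)]) (le_abs_self _))
      · exact (h' s hs hsI x hx n hn).trans
          (le_trans (by linarith [abs_nonneg (g x)]) (le_abs_self _))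
    · intro t ht
      obtain ⟨ε, hε, g, hg, h⟩ := hu.locUnif t ht
      refine ⟨Metric.ball t ε, mem_nhdsWithin_of_mem_nhds (Metric.ball_mem_nhds t hε),
        g, hg, fun s hs hsI x hx n hn => ?_⟩
      have := h s hsI (by simpa [Real.dist_eq] using hs) x hx n hn
      exact (le_trans (by nlinarith [sq_nonneg (iteratedDeriv n (fun z => u z s) x)]) this).trans
        (le_abs_self _)
  obtain ⟨g, hg, h⟩ := hG
  have hfr : ∃ᶠ R in atBot, |g R| ≤ δ := by
    intro hcon
    obtain ⟨A, hA⟩ := eventually_atBot.1 hcon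
    have hfin := Integrable.measure_gt_lt_top hg.norm (ε := δ) hδ
    have hle : (volume : Measure ℝ) (Iio (min A 0)) ≤
        (volume.restrict (Iio (0:ℝ))) {a | δ < ‖g a‖} := by
      rw [Measure.restrict_apply' measurableSet_Iio]
      apply measure_mono
      intro x hx
      have hx' := lt_min_iff.1 (mem_Iio.1 hx)
      exact ⟨by simpa using hA x hx'.1.le, hx'.2⟩
    rw [Real.volume_Iio] at hle
    exact absurd (hle.trans_lt hfin) (lt_irrefl _)
  refine (hfr.and_eventually (eventually_lt_atBot 0)).mono ?_
  rintro R ⟨h1, h2⟩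
  exact ⟨h2, fun s hs n hn => (h s hs hs R h2 n hn).trans h1⟩

lemma kdv_bdd {f : ℝ → ℝ} (hf : Continuous f) (hl : Tendsto f atBot (𝓝 0)) :
    ∃ C, ∀ x ≤ 0, ‖f x‖ ≤ C := by
  have h1 : ∀ᶠ x in atBot, ‖f x‖ < 1 := by
    have := hl.norm
    rw [norm_zero] at this
    exact this.eventually (gt_mem_nhds one_pos)
  obtain ⟨A, hA⟩ := eventually_atBot.1 h1
  obtain ⟨C, hC⟩ := (isCompact_Icc (a := A) (b := (0:ℝ))).exists_bound_of_continuousOn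
    hf.continuousOn
  refine ⟨max C 1, fun x hx => ?_⟩
  rcases le_total x A with h | h
  · exact (hA x h).le.trans (le_max_right _ _)
  · exact (hC x ⟨h, hx⟩).trans (le_max_left _ _)

theorem mass_energy_dissipation_left (T : ℝ) (hT : 0 < T) (u : ℝ → ℝ → ℝ)
    (hu : LeftKdVSolution u (Icc (-T) 0)) (hbc : ∀ t ∈ Icc (-T) (0 : ℝ), u 0 t = 0)
    (t : ℝ) (ht : t ∈ Icc (-T) (0 : ℝ)) :
    (1 / 2) * ∫ x in Iio (0 : ℝ), (u x t) ^ 2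
      ≤ (1 / 2) * ∫ x in Iio (0 : ℝ), (u x 0) ^ 2 ∧
    (∫ x in Iio (0 : ℝ),
        ((1 / 2) * (deriv (fun y => u y t) x) ^ 2 - (1 / 3) * (u x t) ^ 3))
      ≤ ∫ x in Iio (0 : ℝ),
          ((1 / 2) * (deriv (fun y => u y 0) x) ^ 2 - (1 / 3) * (u x 0) ^ 3) := by
  obtain ⟨U, hU⟩ : ∃ U, U = Function.uncurry u := ⟨_, rfl⟩
  have hUu : ∀ x s, u x s = U (x, s) := fun x s => by rw [hU]; rfl
  have s0 : ContDiff ℝ (⊤ : ℕ∞) U := hU ▸ hu.smooth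
  obtain ⟨V, hV⟩ : ∃ V, V = kdvDx U := ⟨_, rfl⟩
  obtain ⟨W, hW⟩ : ∃ W, W = kdvDx V := ⟨_, rfl⟩
  obtain ⟨Z, hZ⟩ : ∃ Z, Z = kdvDx W := ⟨_, rfl⟩
  obtain ⟨P, hP⟩ : ∃ P, P = kdvDt U := ⟨_, rfl⟩
  obtain ⟨Q, hQ⟩ : ∃ Q, Q = kdvDx P := ⟨_, rfl⟩
  have s1 : ContDiff ℝ (⊤ : ℕ∞) V := hV ▸ kdvDx_smooth s0
  have s2 : ContDiff ℝ (⊤ : ℕ∞) W := hW ▸ kdvDx_smooth s1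
  have sP : ContDiff ℝ (⊤ : ℕ∞) P := hP ▸ kdvDt_smooth s0
  have sQ : ContDiff ℝ (⊤ : ℕ∞) Q := hQ ▸ kdvDx_smooth sP
  have c0 := s0.continuous
  have c1 := s1.continuous
  have c2 := s2.continuous
  have cP := sP.continuous
  have cQ := sQ.continuous
  have d0 : ∀ x s, HasDerivAt (fun y => U (y, s)) (V (x, s)) x := fun x s =>
    hV ▸ kdvDx_hasDeriv s0 x s
  have d1 : ∀ x s, HasDerivAt (fun y => V (y, s)) (W (x, s)) x := fun x s =>
    hW ▸ kdvDx_hasDeriv s1 x s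
  have d2 : ∀ x s, HasDerivAt (fun y => W (y, s)) (Z (x, s)) x := fun x s =>
    hZ ▸ kdvDx_hasDeriv s2 x s
  have dP : ∀ x s, HasDerivAt (fun y => P (y, s)) (Q (x, s)) x := fun x s =>
    hQ ▸ kdvDx_hasDeriv sP x s
  have dt0 : ∀ x s, HasDerivAt (fun r => U (x, r)) (P (x, s)) s := fun x s =>
    hP ▸ kdvDt_hasDeriv s0 x s
  have dt1 : ∀ x s, HasDerivAt (fun r => V (x, r)) (Q (x, s)) s := fun x s => by
    have h := kdvDt_hasDeriv s1 x s
    rwa [hV, kdvD_comm s0, ← hV, ← hP, ← hQ] at h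
  have i0 : ∀ s x, iteratedDeriv 0 (fun z => u z s) x = U (x, s) := fun s x => by
    rw [(kdv_iter hu.smooth 0).2 s, hU]; rfl
  have i1 : ∀ s x, iteratedDeriv 1 (fun z => u z s) x = V (x, s) := fun s x => by
    rw [(kdv_iter hu.smooth 1).2 s, hV, hU]; rfl
  have i2 : ∀ s x, iteratedDeriv 2 (fun z => u z s) x = W (x, s) := fun s x => by
    rw [(kdv_iter hu.smooth 2).2 s, hW, hV, hU]; rfl
  have i3 : ∀ s x, iteratedDeriv 3 (fun z => u z s) x = Z (x, s) := fun s x => by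
    rw [(kdv_iter hu.smooth 3).2 s, hZ, hW, hV, hU]; rfl
  have eqn : ∀ x ≤ 0, ∀ s ∈ Icc (-T) (0:ℝ),
      P (x, s) = -(Z (x, s) + 2 * U (x, s) * V (x, s)) := by
    intro x hx s hs
    have h := hu.eqn x hx s hs
    simp only [i2] at h
    simp only [hUu] at h
    have hd : HasDerivAt (fun y => W (y, s) + U (y, s) ^ 2)
        (Z (x, s) + 2 * U (x, s) * V (x, s)) x := by
      refine ((d2 x s).add ((d0 x s).pow 2)).congr_deriv ?_
      norm_num
    rw [(dt0 x s).deriv, hd.deriv] at h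
    linarith
  have bc : ∀ s ∈ Icc (-T) (0:ℝ), U (0, s) = 0 := fun s hs => by rw [← hUu]; exact hbc s hs
  have bcP : ∀ s ∈ Icc (-T) (0:ℝ), P (0, s) = 0 := by
    intro s hs
    have h1 : HasDerivWithinAt (fun r => U (0, r)) (P (0, s)) (Icc (-T) 0) s :=
      (dt0 0 s).hasDerivWithinAt
    have h2 : HasDerivWithinAt (fun r => U (0, r)) 0 (Icc (-T) 0) s :=
      (hasDerivWithinAt_const s (Icc (-T) 0) (0:ℝ)).congr bc (bc s hs)
    exact (uniqueDiffOn_Icc (by linarith) s hs).eq_deriv _ h1 h2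
  have small : ∀ δ : ℝ, 0 < δ → ∃ᶠ R in atBot, R < 0 ∧ ∀ s ∈ Icc (-T) (0:ℝ),
      |U (R, s)| ≤ δ ∧ |V (R, s)| ≤ δ ∧ |W (R, s)| ≤ δ ∧ |Z (R, s)| ≤ δ := by
    intro δ hδ
    refine (kdv_small hu δ hδ).mono ?_
    rintro R ⟨hR, h⟩
    refine ⟨hR, fun s hs => ⟨?_, ?_, ?_, ?_⟩⟩
    · rw [← i0]; exact h s hs 0 (by norm_num)
    · rw [← i1]; exact h s hs 1 (by norm_num)
    · rw [← i2]; exact h s hs 2 (by norm_num)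
    · rw [← i3]; exact h s hs 3 (by norm_num)
  have int0 : ∀ s ∈ Icc (-T) (0:ℝ), IntegrableOn (fun x => U (x, s) ^ 2) (Iio 0) := by
    intro s hs
    have h := hu.int2 s hs 0 (by norm_num)
    simpa only [i0] using h
  have int1 : ∀ s ∈ Icc (-T) (0:ℝ), IntegrableOn (fun x => V (x, s) ^ 2) (Iio 0) := by
    intro s hs
    have h := hu.int2 s hs 1 (by norm_num)
    simpa only [i1] using h
  have int3 : ∀ s ∈ Icc (-T) (0:ℝ), IntegrableOn (fun x => U (x, s) ^ 3) (Iio 0) := by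
    intro s hs
    have hdec := hu.decay s hs 0 (by norm_num)
    simp only [i0] at hdec
    have hc : Continuous (fun x => U (x, s)) := by fun_prop
    obtain ⟨C, hC⟩ := kdv_bdd hc hdec
    have h := Integrable.bdd_mul (c := C) (int0 s hs) hc.aestronglyMeasurable
      ((ae_restrict_iff' measurableSet_Iio).2 (Eventually.of_forall fun x hx => hC x (le_of_lt hx)))
    refine h.congr (Eventually.of_forall fun x => ?_)
    ring
  constructor
  · have key := kdv_core T t ht (fun x s => (1/2) * U (x, s) ^ 2)
      (fun x s => -(U (x, s) * W (x, s) - (1/2) * V (x, s) ^ 2 + (2/3) * U (x, s) ^ 3))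
      (fun x s => U (x, s) * P (x, s)) ?_ ?_ ?_ ?_ ?_ ?_
    · simp only [hUu]
      rw [← integral_const_mul, ← integral_const_mul]
      exact key
    · intro x s
      refine (((dt0 x s).pow 2).const_mul (1/2)).congr_deriv ?_
      norm_num; ring
    · intro x hx s hs
      refine ((((d0 x s).mul (d2 x s)).sub (((d1 x s).pow 2).const_mul (1/2))).add
        (((d0 x s).pow 3).const_mul (2/3))).neg.congr_deriv ?_
      rw [eqn x hx s hs]
      norm_num; ring
    · simp only [Function.uncurry_def]; fun_prop
    · intro s; fun_prop
    · intro s hs; exact (int0 s hs).const_mul _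
    · intro δ h0 h1
      refine (small δ h0).mono ?_
      rintro R ⟨hR, h⟩ s hs
      obtain ⟨a0, a1, a2, a3⟩ := h s hs
      simp only [bc s hs]
      have b0 : |U (R, s) * W (R, s)| ≤ δ * 1 := by
        rw [abs_mul]; exact mul_le_mul a0 (a2.trans h1) (abs_nonneg _) h0.le
      have b1 : V (R, s) ^ 2 ≤ δ * 1 := by
        rw [← sq_abs, pow_two]; exact mul_le_mul a1 (a1.trans h1) (abs_nonneg _) h0.le
      have b2 : |U (R, s) ^ 3| ≤ δ * 1 := by
        rw [pow_succ', abs_mul, abs_pow]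
        exact mul_le_mul a0 (pow_le_one₀ (abs_nonneg _) (a0.trans h1)) (by positivity) h0.le
      have := abs_le.1 b0
      have := abs_le.1 b2
      nlinarith [sq_nonneg (V (0, s))]
  · have hde : ∀ s x, deriv (fun y => u y s) x = V (x, s) := fun s x => by
      rw [← i1, iteratedDeriv_one]
    have key := kdv_core T t ht (fun x s => (1/2) * V (x, s) ^ 2 - (1/3) * U (x, s) ^ 3)
      (fun x s => V (x, s) * P (x, s) + (1/2) * (W (x, s) + U (x, s) ^ 2) ^ 2)
      (fun x s => V (x, s) * Q (x, s) - U (x, s) ^ 2 * P (x, s)) ?_ ?_ ?_ ?_ ?_ ?_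
    · simp only [hUu] at hde ⊢
      simp only [hde]
      exact key
    · intro x s
      refine ((((dt1 x s).pow 2).const_mul (1/2)).sub
        (((dt0 x s).pow 3).const_mul (1/3))).congr_deriv ?_
      norm_num; ring
    · intro x hx s hs
      refine (((d1 x s).mul (dP x s)).add
        ((((d2 x s).add ((d0 x s).pow 2)).pow 2).const_mul (1/2))).congr_deriv ?_
      simp only [Pi.add_apply, Pi.pow_apply]
      rw [eqn x hx s hs]
      norm_num; ring
    · simp only [Function.uncurry_def]; fun_prop
    · intro s; fun_prop
    · intro s hs; exact ((int1 s hs).const_mul _).sub ((int3 s hs).const_mul _)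
    · intro δ h0 h1
      refine (small δ h0).mono ?_
      rintro R ⟨hR, h⟩ s hs
      obtain ⟨a0, a1, a2, a3⟩ := h s hs
      simp only [bcP s hs, eqn R hR.le s hs]
      have b0 : |V (R, s) * Z (R, s)| ≤ δ * 1 := by
        rw [abs_mul]; exact mul_le_mul a1 (a3.trans h1) (abs_nonneg _) h0.le
      have b1 : V (R, s) ^ 2 ≤ δ * 1 := by
        rw [← sq_abs, pow_two]; exact mul_le_mul a1 (a1.trans h1) (abs_nonneg _) h0.le
      have b2 : |U (R, s) * V (R, s) ^ 2| ≤ δ * 1 := by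
        rw [abs_mul, abs_pow]
        exact mul_le_mul a0 (pow_le_one₀ (abs_nonneg _) (a1.trans h1)) (by positivity) h0.le
      have b3 : W (R, s) ^ 2 ≤ δ * 1 := by
        rw [← sq_abs, pow_two]; exact mul_le_mul a2 (a2.trans h1) (abs_nonneg _) h0.le
      have b4 : (U (R, s) ^ 2) ^ 2 ≤ δ * 1 := by
        have e4 : (U (R, s) ^ 2) ^ 2 = |U (R, s)| * |U (R, s)| ^ 3 := by
          rw [← sq_abs (U (R, s))]; ring
        rw [e4]
        exact mul_le_mul a0 (pow_le_one₀ (abs_nonneg _) (a0.trans h1)) (by positivity) h0.le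
      have := abs_le.1 b0
      have := abs_le.1 b2
      nlinarith [sq_nonneg (W (0, s) + U (0, s) ^ 2), sq_nonneg (W (R, s) - U (R, s) ^ 2)]
end
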